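/- Let G = (V, E, s) be a graph in which every node is reachable from s and with |V| ≥ 2. Then every nesting decomposition of G has width at least 1 + max{ |S^a_i| : a ∈ V, 1 ≤ i ≤ k_a }. -/

import Mathlib

open Relation

variable {V : Type*}

/-- `p` is a path from `a` to `b` in the arc relation `E`:
a nonempty list of nodes starting at `a`, ending at `b`,
in which every consecutive pair of nodes is an arc. -/
def IsPath (E : V → V → Prop) (a b : V) (p : List V) : Prop :=
  p ≠ [] ∧ p.head? = some a ∧ p.getLast? = some b ∧ p.Chain' E

/-- `a` dominates `b` (written `a ≥_s b`): every path from `s` to `b` contains `a`. -/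
def Dom (E : V → V → Prop) (s a b : V) : Prop :=
  ∀ p : List V, IsPath E s b p → a ∈ p

/-- `m` is a source of module `M`: `m ∈ M`, every arc entering `M` from outside goes
to `m`, and (convention) if `s ∈ M` then `m = s`. -/
def ModuleSource (E : V → V → Prop) (s : V) (M : Set V) (m : V) : Prop :=
  m ∈ M ∧ (∀ u v, E u v → u ∉ M → v ∈ M → v = m) ∧ (s ∈ M → m = s)

/-- `M` is a module of the graph `(V, E, s)`. -/
def IsModule (E : V → V → Prop) (s : V) (M : Set V) : Prop :=
  ∃ m, ModuleSource E s M m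

/-- Two sets overlap: they intersect but neither contains the other. -/
def Overlap (M H : Set V) : Prop :=
  (M ∩ H).Nonempty ∧ ¬ M ⊆ H ∧ ¬ H ⊆ M

/-- A nesting decomposition: a collection of pairwise non-overlapping modules
containing the trivial modules (the whole node set and all singletons). -/
def IsNestingDecomp (E : V → V → Prop) (s : V) (F : Set (Set V)) : Prop :=
  (∀ M ∈ F, IsModule E s M) ∧
  (∀ M ∈ F, ∀ H ∈ F, ¬ Overlap M H) ∧
  (Set.univ : Set V) ∈ F ∧
  (∀ v : V, ({v} : Set V) ∈ F)

/-- The maximal module partition of `M` within the family `F`. -/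
def MaxPartition (F : Set (Set V)) (M : Set V) : Set (Set V) :=
  {H | H ∈ F ∧ H ⊂ M ∧ ¬ ∃ K ∈ F, H ⊂ K ∧ K ⊂ M}

/-- The width of a nesting decomposition `F`. -/
noncomputable def NDWidth (F : Set (Set V)) : ℕ :=
  ⨆ M ∈ F, (MaxPartition F M).ncard

/-- The nesting width of the graph `(V, E, s)`. -/
noncomputable def nestingWidth (E : V → V → Prop) (s : V) : ℕ :=
  sInf {w : ℕ | ∃ F : Set (Set V), IsNestingDecomp E s F ∧ NDWidth F = w}

/-- `D(a)`: the set of nodes dominated by `a`. -/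
def DomSet (E : V → V → Prop) (s a : V) : Set V := {v | Dom E s a v}

/-- `v` is a child of `a` in the dominator tree. -/
def IsChild (E : V → V → Prop) (s a v : V) : Prop :=
  v ≠ a ∧ Dom E s a v ∧ ∀ b, b ≠ a → b ≠ v → ¬(Dom E s a b ∧ Dom E s b v)

/-- `C(a)`: the set of children of `a` in the dominator tree. -/
def Children (E : V → V → Prop) (s a : V) : Set V := {v | IsChild E s a v}

/-- The arc relation of the graph `G_a` on the children of `a`. -/
def GArc (E : V → V → Prop) (s a : V) (u v : V) : Prop :=
  u ∈ Children E s a ∧ v ∈ Children E s a ∧ u ≠ v ∧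
    ∃ x y, E x y ∧ x ∈ DomSet E s u ∧ y ∈ DomSet E s v

/-- `S` is a strongly connected component of `G_a`
(an equivalence class of mutual reachability in `G_a`). -/
def IsSCC (E : V → V → Prop) (s a : V) (S : Set V) : Prop :=
  ∃ u ∈ Children E s a,
    S = {v | v ∈ Children E s a ∧ ReflTransGen (GArc E s a) u v ∧
          ReflTransGen (GArc E s a) v u}

/-- `L` lists the strongly connected components of `G_a` in topological order:
each member is an SCC of `G_a`, every child of `a` lies in exactly one listed
component, and every arc of `G_a` goes from an earlier component to the same
or a later component. -/
def IsTopoSCCList (E : V → V → Prop) (s a : V) (L : List (Set V)) : Prop :=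
  (∀ S ∈ L, IsSCC E s a S) ∧
  (∀ v ∈ Children E s a, ∃! i : Fin L.length, v ∈ L.get i) ∧
  (∀ i j : Fin L.length, ∀ u ∈ L.get i, ∀ v ∈ L.get j, GArc E s a u v → i ≤ j)

/-- `D(S) = ⋃_{v ∈ S} D(v)`. -/
def DSet (E : V → V → Prop) (s : V) (S : Set V) : Set V := ⋃ v ∈ S, DomSet E s v

/-- The set `{a} ∪ ⋃_{i=1}^{j} D(S^a_i)` (components indexed from 0 in the list). -/
def PrefixModule (E : V → V → Prop) (s a : V) (L : List (Set V)) (j : ℕ) : Set V :=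
  {a} ∪ ⋃ i ∈ Finset.range j, DSet E s (L.getD i ∅)

/-- The A-C family determined by a choice `L` of topologically ordered SCC lists. -/
def ACFamily (E : V → V → Prop) (s : V) (L : V → List (Set V)) : Set (Set V) :=
  {M | ∃ (a : V) (j : ℕ), j ≤ (L a).length ∧ M = PrefixModule E s a (L a) j}

/-- The quantity `max { |S^a_i| : a ∈ V, 1 ≤ i ≤ k_a }`. -/
noncomputable def MaxSCCSize (L : V → List (Set V)) : ℕ :=
  ⨆ a : V, ⨆ i ∈ Finset.range (L a).length, ((L a).getD i ∅).ncard

/-- `AvoidReach E s a b`: there is a path from `s` to `b` that does not contain `a`. -/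
inductive AvoidReach (E : V → V → Prop) (s a : V) : V → Prop
  | base : s ≠ a → AvoidReach E s a s
  | step {x y : V} : AvoidReach E s a x → E x y → y ≠ a → AvoidReach E s a y

lemma AvoidReach.ne {E : V → V → Prop} {s a b : V} (h : AvoidReach E s a b) : b ≠ a := by
  cases h <;> assumption

lemma AvoidReach.exists_isPath {E : V → V → Prop} {s a b : V} (h : AvoidReach E s a b) :
    ∃ p, IsPath E s b p ∧ a ∉ p := by
  induction h with
  | base hs => exact ⟨[s], ⟨by simp, by simp, by simp, List.isChain_singleton _⟩,
      by simpa using hs.symm⟩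
  | @step x y _ hxy hy ih =>
    obtain ⟨p, ⟨hne, hhead, hlast, hchain⟩, hap⟩ := ih
    refine ⟨p ++ [y], ⟨by simp, ?_, by simp, ?_⟩, ?_⟩
    · rw [List.head?_append_of_ne_nil _ hne, hhead]
    · refine List.isChain_append.2 ⟨hchain, List.isChain_singleton _, ?_⟩
      intro u hu v hv
      simp_all
    · simp [hap, hy.symm]

lemma IsPath.avoidReach {E : V → V → Prop} {s a b : V} {p : List V} (hp : IsPath E s b p)
    (ha : a ∉ p) : AvoidReach E s a b := by
  induction p using List.reverseRecOn generalizing b with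
  | nil => exact absurd rfl hp.1
  | append_singleton q y ih =>
    obtain ⟨-, hhead, hlast, hchain⟩ := hp
    obtain rfl : y = b := by simpa using hlast
    have hya : y ≠ a := fun h => ha (by simp [h])
    rcases List.eq_nil_or_concat q with rfl | ⟨r, x, rfl⟩
    · obtain rfl : y = s := by simpa using hhead
      exact .base hya
    · obtain ⟨h₁, -, h₂⟩ := List.isChain_append.1 hchain
      refine .step (ih (b := x) ⟨by simp, ?_, by simp, h₁⟩ ?_) (h₂ x (by simp) y (by simp)) hya
      · rwa [List.head?_append_of_ne_nil _ (by simp)] at hhead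
      · exact fun h => ha (List.mem_append_left _ h)

lemma dom_iff_not_avoidReach {E : V → V → Prop} {s a b : V} :
    Dom E s a b ↔ ¬ AvoidReach E s a b := by
  constructor
  · intro h hab
    obtain ⟨p, hp, hap⟩ := hab.exists_isPath
    exact hap (h p hp)
  · intro h p hp
    by_contra hap
    exact h (hp.avoidReach hap)

lemma IsPath.induction {E : V → V → Prop} {s b : V} {p : List V} (hp : IsPath E s b p)
    {motive : V → Prop} (base : motive s) (step : ∀ x y, motive x → E x y → motive y) :
    motive b := by
  induction p using List.reverseRecOn generalizing b with
  | nil => exact absurd rfl hp.1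
  | append_singleton q y ih =>
    obtain ⟨-, hhead, hlast, hchain⟩ := hp
    obtain rfl : y = b := by simpa using hlast
    rcases List.eq_nil_or_concat q with rfl | ⟨r, x, rfl⟩
    · obtain rfl : y = s := by simpa using hhead
      exact base
    · obtain ⟨h₁, -, h₂⟩ := List.isChain_append.1 hchain
      refine step x y (ih (b := x) ⟨by simp, ?_, by simp, h₁⟩) (h₂ x (by simp) y (by simp))
      rwa [List.head?_append_of_ne_nil _ (by simp)] at hhead

lemma Dom.refl (E : V → V → Prop) (s a : V) : Dom E s a a :=
  dom_iff_not_avoidReach.2 fun h => h.ne rfl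

lemma Dom.trans {E : V → V → Prop} {s a b c : V} (hab : Dom E s a b) (hbc : Dom E s b c) :
    Dom E s a c := by
  rw [dom_iff_not_avoidReach] at *
  intro hac
  apply hbc
  clear hbc
  induction hac with
  | base hs => exact .base fun h => hab (h ▸ .base hs)
  | step hx hxy hy ih =>
    exact .step ih hxy fun h => hab (h ▸ .step hx hxy hy)

lemma Dom.antisymm {E : V → V → Prop} {s a b : V} (hreach : ∀ v : V, ∃ p, IsPath E s v p)
    (hab : Dom E s a b) (hba : Dom E s b a) : a = b := by
  by_contra hne
  rw [dom_iff_not_avoidReach] at hab hba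
  obtain ⟨p, hp⟩ := hreach a
  refine (hp.induction (motive := fun w => AvoidReach E s a w ∧ AvoidReach E s b w) ?_ ?_).1.ne rfl
  · have hsa : s ≠ a := fun h => hba (h ▸ .base fun h' => hne (h.symm.trans h'))
    have hsb : s ≠ b := fun h => hab (h ▸ .base hsa)
    exact ⟨.base hsa, .base hsb⟩
  · rintro x y ⟨hxa, hxb⟩ hxy
    have hya : y ≠ a := fun h => hba (h ▸ .step hxb hxy fun h' => hne (h.symm.trans h'))
    have hyb : y ≠ b := fun h => hab (h ▸ .step hxa hxy hya)
    exact ⟨.step hxa hxy hya, .step hxb hxy hyb⟩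

/-- The dominators of a node form a chain. -/
lemma Dom.total {E : V → V → Prop} {s a b c : V} (hreach : ∀ v : V, ∃ p, IsPath E s v p)
    (hac : Dom E s a c) (hbc : Dom E s b c) : Dom E s a b ∨ Dom E s b a := by
  by_contra! h
  obtain ⟨hab, hba⟩ := h
  rw [dom_iff_not_avoidReach] at hac hbc
  rw [dom_iff_not_avoidReach, not_not] at hab hba
  obtain ⟨p, hp⟩ := hreach c
  refine (hp.induction (motive := fun w => AvoidReach E s a w ∨ AvoidReach E s b w) ?_ ?_).elim
    hac hbc
  · by_cases hs : s = a
    · exact .inr (.base fun h => hba.ne (hs.symm.trans h))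
    · exact .inl (.base hs)
  · rintro x y (hx | hx) hxy
    · by_cases hy : y = a
      · exact .inr (hy ▸ hba)
      · exact .inl (.step hx hxy hy)
    · by_cases hy : y = b
      · exact .inl (hy ▸ hab)
      · exact .inr (.step hx hxy hy)

/-- The source of a module dominates the module. -/
lemma ModuleSource.dom {E : V → V → Prop} {s m v : V} {M : Set V} (h : ModuleSource E s M m)
    (hv : v ∈ M) : Dom E s m v := by
  rw [dom_iff_not_avoidReach]
  intro hmv
  have key : ∀ w, AvoidReach E s m w → w ∉ M := by
    intro w hw
    induction hw with
    | base hs => exact fun hsM => hs (h.2.2 hsM).symm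
    | step _ hxy hy ih => exact fun hyM => hy (h.2.1 _ _ hxy ih hyM)
  exact key v hmv hv

/-- A module contains every node dominated by its source that dominates one of its nodes. -/
lemma ModuleSource.mem_of_dom_of_dom {E : V → V → Prop} {s m a x : V} {M : Set V}
    (hreach : ∀ v : V, ∃ p, IsPath E s v p) (h : ModuleSource E s M m)
    (hma : Dom E s m a) (hax : Dom E s a x) (hx : x ∈ M) : a ∈ M := by
  by_contra haM
  have ham : ¬ Dom E s a m := fun ham => haM (hma.antisymm hreach ham ▸ h.1)
  rw [dom_iff_not_avoidReach, not_not] at ham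
  rw [dom_iff_not_avoidReach] at hax
  obtain ⟨p, hp⟩ := hreach x
  refine hax (hp.induction (motive := fun w => w ∈ M → AvoidReach E s a w) ?_ ?_ hx)
  · intro hs
    exact h.2.2 hs ▸ ham
  · intro u v ih huv hv
    by_cases hu : u ∈ M
    · exact .step (ih hu) huv fun hva => haM (hva ▸ hv)
    · exact h.2.1 u v huv hu hv ▸ ham

lemma IsChild.dom_of_dom {E : V → V → Prop} {s a v m : V}
    (hreach : ∀ v : V, ∃ p, IsPath E s v p) (hv : IsChild E s a v) (hm : Dom E s m v)
    (hne : m ≠ v) : Dom E s m a := by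
  rcases hm.total hreach hv.2.1 with h | h
  · exact h
  · by_cases hma : m = a
    · exact hma ▸ Dom.refl E s m
    · exact absurd ⟨h, hm⟩ (hv.2.2 m hma hne)

lemma IsChild.eq_of_dom {E : V → V → Prop} {s a u v : V}
    (hreach : ∀ v : V, ∃ p, IsPath E s v p) (hu : IsChild E s a u) (hv : IsChild E s a v)
    (huv : Dom E s u v) : u = v := by
  by_contra hne
  exact hu.1 ((hv.dom_of_dom hreach huv hne).antisymm hreach hu.2.1)

/-- An arc entering `D(v)` from a different child of the same node ends at `v`. -/
lemma IsChild.eq_of_arc {E : V → V → Prop} {s a u v x y : V}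
    (hreach : ∀ v : V, ∃ p, IsPath E s v p) (hu : IsChild E s a u) (hv : IsChild E s a v)
    (hne : u ≠ v) (hxy : E x y) (hx : Dom E s u x) (hy : Dom E s v y) : y = v := by
  have hvx : ¬ Dom E s v x := fun hvx => (hx.total hreach hvx).elim
    (fun h => hne (hu.eq_of_dom hreach hv h)) (fun h => hne (hv.eq_of_dom hreach hu h).symm)
  rw [dom_iff_not_avoidReach, not_not] at hvx
  rw [dom_iff_not_avoidReach] at hy
  by_contra hyv
  exact hy (.step hvx hxy hyv)

/-- A module containing `a` is closed under predecessors in `G_a`. -/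
lemma ModuleSource.mem_of_gArc {E : V → V → Prop} {s m a u v : V} {M : Set V}
    (hreach : ∀ v : V, ∃ p, IsPath E s v p) (h : ModuleSource E s M m)
    (ha : a ∈ M) (huv : GArc E s a u v) (hv : v ∈ M) : u ∈ M := by
  obtain ⟨hu, hv', hne, x, y, hxy, hx, hy⟩ := huv
  obtain rfl := hu.eq_of_arc hreach hv' hne hxy hx hy
  have hma := h.dom ha
  have hxM : x ∈ M := by
    by_contra hxM
    have hym := h.2.1 x y hxy hxM hv
    exact hv'.1 ((hym ▸ hma).antisymm hreach hv'.2.1)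
  exact h.mem_of_dom_of_dom hreach (hma.trans hu.2.1) hx hxM

lemma ModuleSource.mem_of_reflTransGen {E : V → V → Prop} {s m a u v : V} {M : Set V}
    (hreach : ∀ v : V, ∃ p, IsPath E s v p) (h : ModuleSource E s M m)
    (ha : a ∈ M) (huv : ReflTransGen (GArc E s a) u v) (hv : v ∈ M) : u ∈ M := by
  induction huv using ReflTransGen.head_induction_on with
  | refl => exact hv
  | head hab _ ih => exact h.mem_of_gArc hreach ha hab ih

/-- A module containing two siblings contains their parent. -/
lemma ModuleSource.parent_mem {E : V → V → Prop} {s m a x y : V} {M : Set V}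
    (hreach : ∀ v : V, ∃ p, IsPath E s v p) (h : ModuleSource E s M m)
    (hx : IsChild E s a x) (hy : IsChild E s a y) (hne : x ≠ y) (hxM : x ∈ M) (hyM : y ∈ M) :
    a ∈ M := by
  have hmx : m ≠ x := fun hm => hne (hx.eq_of_dom hreach hy (hm ▸ h.dom hyM))
  exact h.mem_of_dom_of_dom hreach (hx.dom_of_dom hreach (h.dom hxM) hmx) hx.2.1 hxM

/-- A module containing two nodes among `a` and a strongly connected component of `G_a`
contains `a` and the whole component. -/
lemma IsModule.insert_subset {E : V → V → Prop} {s a x y : V} {M S : Set V}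
    (hreach : ∀ v : V, ∃ p, IsPath E s v p) (h : IsModule E s M) (hS : IsSCC E s a S)
    (hx : x ∈ insert a S) (hy : y ∈ insert a S) (hne : x ≠ y) (hxM : x ∈ M) (hyM : y ∈ M) :
    insert a S ⊆ M := by
  obtain ⟨m, hm⟩ := h
  obtain ⟨r, -, rfl⟩ := hS
  have key : ∀ z ∈ {v | v ∈ Children E s a ∧ ReflTransGen (GArc E s a) r v ∧
      ReflTransGen (GArc E s a) v r}, a ∈ M → z ∈ M →
      insert a {v | v ∈ Children E s a ∧ ReflTransGen (GArc E s a) r v ∧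
        ReflTransGen (GArc E s a) v r} ⊆ M := by
    rintro z ⟨-, hrz, -⟩ ha hz w (rfl | ⟨-, -, hwr⟩)
    · exact ha
    · exact hm.mem_of_reflTransGen hreach ha (hwr.trans hrz) hz
  rcases hx with rfl | hx <;> rcases hy with rfl | hy
  · exact absurd rfl hne
  · exact key y hy hxM hyM
  · exact key x hx hyM hxM
  · exact key x hx (hm.parent_mem hreach hx.1 hy.1 hne hxM hyM) hxM

lemma exists_mem_maxPartition [Finite V] {F : Set (Set V)} (hF : ∀ v : V, {v} ∈ F)
    {M : Set V} {x : V} (hx : {x} ⊂ M) : ∃ H ∈ MaxPartition F M, x ∈ H := by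
  obtain ⟨H, ⟨hHF, hxH, hHM⟩, hmax⟩ :=
    (Set.toFinite {H | H ∈ F ∧ x ∈ H ∧ H ⊂ M}).exists_maximal ⟨{x}, hF x, rfl, hx⟩
  refine ⟨H, ⟨hHF, hHM, ?_⟩, hxH⟩
  rintro ⟨K, hKF, hHK, hKM⟩
  exact hHK.2 (hmax ⟨hKF, hHK.1 hxH, hKM⟩ hHK.1)

lemma ncard_maxPartition_le_ndWidth [Finite V] {F : Set (Set V)} {M : Set V} (hM : M ∈ F) :
    (MaxPartition F M).ncard ≤ NDWidth F :=
  le_ciSup_of_le (Set.finite_range _).bddAbove M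
    (le_ciSup_of_le (Set.finite_range _).bddAbove hM le_rfl)

/-- The width exceeds the size of every strongly connected component of every `G_a`. -/
lemma IsSCC.ncard_lt_ndWidth [Finite V] {E : V → V → Prop} {s a : V} {S : Set V}
    {F : Set (Set V)} (hreach : ∀ v : V, ∃ p, IsPath E s v p) (hF : IsNestingDecomp E s F)
    (hS : IsSCC E s a S) : S.ncard < NDWidth F := by
  obtain ⟨hmod, -, huniv, hsing⟩ := hF
  have haS : a ∉ S := by
    obtain ⟨r, -, rfl⟩ := hS
    exact fun h => h.1.1 rfl
  obtain ⟨M, ⟨hMF, hSM⟩, hmin⟩ :=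
    (Set.toFinite {M | M ∈ F ∧ insert a S ⊆ M}).exists_minimal ⟨Set.univ, huniv, Set.subset_univ _⟩
  have hnontriv : M.Nontrivial := by
    obtain ⟨r, hr, rfl⟩ := hS
    exact ⟨r, hSM (.inr ⟨hr, .refl, .refl⟩), a, hSM (.inl rfl), hr.1⟩
  have hpart : ∀ x ∈ insert a S, ∃ H ∈ MaxPartition F M, x ∈ H := fun x hx =>
    exists_mem_maxPartition hsing <| (Set.singleton_subset_iff.2 (hSM hx)).ssubset_of_ne
      fun h => (h ▸ hnontriv).ne_singleton rfl
  choose! f hf hxf using hpart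
  have hinj : Set.InjOn f (insert a S) := by
    intro x hx y hy hxy
    by_contra hne
    have hsub := (hmod _ (hf x hx).1).insert_subset hreach hS hx hy hne (hxf x hx)
      (hxy ▸ hxf y hy)
    exact (hf x hx).2.1.2 (hmin ⟨(hf x hx).1, hsub⟩ (hf x hx).2.1.1)
  have hle := Set.ncard_le_ncard_of_injOn f hf hinj
  rw [Set.ncard_insert_of_notMem haS] at hle
  exact hle.trans (ncard_maxPartition_le_ndWidth hMF)

lemma IsNestingDecomp.ndWidth_pos [Fintype V] {E : V → V → Prop} {s : V} {F : Set (Set V)}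
    (hcard : 2 ≤ Fintype.card V) (hF : IsNestingDecomp E s F) : 0 < NDWidth F := by
  have : Nontrivial V := Fintype.one_lt_card_iff_nontrivial.1 hcard
  obtain ⟨H, hH, -⟩ := exists_mem_maxPartition (M := Set.univ) (x := s) hF.2.2.2 <|
    (Set.subset_univ _).ssubset_of_ne fun h =>
      (h ▸ Set.nontrivial_univ (α := V)).ne_singleton rfl
  exact ((Set.ncard_pos (Set.toFinite _)).2 ⟨H, hH⟩).trans_le
    (ncard_maxPartition_le_ndWidth hF.2.2.1)

/-- every nesting decomposition of `G` has width at least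
`1 + max{ |S^a_i| : a ∈ V, 1 ≤ i ≤ k_a }`. -/
theorem width_lower_bound [Fintype V] (E : V → V → Prop) (s : V)
    (hreach : ∀ v : V, ∃ p : List V, IsPath E s v p)
    (hcard : 2 ≤ Fintype.card V)
    (L : V → List (Set V)) (hL : ∀ a : V, IsTopoSCCList E s a (L a)) :
    ∀ F : Set (Set V), IsNestingDecomp E s F → 1 + MaxSCCSize L ≤ NDWidth F := by
  intro F hF
  suffices h : MaxSCCSize L ≤ NDWidth F - 1 by
    have := hF.ndWidth_pos hcard
    omega
  refine ciSup_le' fun a => ciSup_le' fun i => ciSup_le' fun hi => Nat.le_sub_one_of_lt ?_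
  have hi' := Finset.mem_range.1 hi
  rw [List.getD_eq_getElem _ _ hi']
  exact ((hL a).1 _ (List.getElem_mem hi')).ncard_lt_ndWidth hreach hF
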